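/- arXiv:2102.09280 — 3 statements merged into one kernel-verified Lean document; each statement's English description precedes it below -/
import Mathlib

section
/- Let λ, μ ∈ ℝ and s > 0, and let Ω ⊆ ℝ² be an open set with Ω ∩ ((−∞,0] × {0}) = ∅. Then the map u(x) = (exp(−s√(x₁+ix₂)), i·exp(−s√(x₁+ix₂))) is infinitely differentiable on Ω and satisfies the Lamé equation ℒu := λΔu + (λ+μ)∇(∇·u) = (0,0) at every point of Ω; explicitly, for k = 1, 2 one has λ(∂₁² + ∂₂²)u_k + (λ+μ)∂_k(∂₁u₁ + ∂₂u₂) = 0 on Ω. -/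
open MeasureTheory Real

/-- Principal complex square root of `x₁ + i x₂`. -/
noncomputable def csqrt (x : ℝ × ℝ) : ℂ :=
  ((x.1 : ℂ) + (x.2 : ℂ) * Complex.I) ^ (1 / 2 : ℂ)

/-- The CGO solution component `exp(-s √(x₁ + i x₂))`. -/
noncomputable def cgo (s : ℝ) (x : ℝ × ℝ) : ℂ :=
  Complex.exp (-(s : ℂ) * csqrt x)

/-- First partial derivative of a ℂ-valued function on ℝ². -/
noncomputable def pd1 (f : ℝ × ℝ → ℂ) (x : ℝ × ℝ) : ℂ := fderiv ℝ f x (1, 0)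

/-- Second partial derivative of a ℂ-valued function on ℝ². -/
noncomputable def pd2 (f : ℝ × ℝ → ℂ) (x : ℝ × ℝ) : ℂ := fderiv ℝ f x (0, 1)

/-- The holomorphic function `z ↦ exp(-s √z)` underlying `cgo`. -/
noncomputable def cgoHol (s : ℝ) (z : ℂ) : ℂ :=
  Complex.exp (-(s : ℂ) * z ^ (1 / 2 : ℂ))

theorem cgo_eq_cgoHol (s : ℝ) :
    cgo s = fun x => cgoHol s (Complex.equivRealProdCLM.symm x) := by
  funext x
  simp only [cgo, csqrt, cgoHol, Complex.equivRealProdCLM_symm_apply]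

theorem differentiableOn_cgoHol (s : ℝ) :
    DifferentiableOn ℂ (cgoHol s) Complex.slitPlane := by
  intro z hz
  have h : DifferentiableAt ℂ (fun w : ℂ => w ^ (1 / 2 : ℂ)) z :=
    differentiableAt_id.cpow (differentiableAt_const _) hz
  exact ((h.const_mul (-(s : ℂ))).cexp).differentiableWithinAt

theorem fderiv_comp_equivRealProdCLM_symm {F : ℂ → ℂ} {x : ℝ × ℝ}
    (hF : DifferentiableAt ℂ F (Complex.equivRealProdCLM.symm x)) (v : ℝ × ℝ) :
    fderiv ℝ (fun y => F (Complex.equivRealProdCLM.symm y)) x v =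
      Complex.equivRealProdCLM.symm v * deriv F (Complex.equivRealProdCLM.symm x) := by
  have h := (hF.hasDerivAt.hasFDerivAt.restrictScalars ℝ).comp x
    Complex.equivRealProdCLM.symm.hasFDerivAt
  have h' : HasFDerivAt (fun y => F (Complex.equivRealProdCLM.symm y)) _ x := h
  rw [h'.fderiv]
  simp

theorem pd1_comp_equivRealProdCLM_symm {F : ℂ → ℂ} {x : ℝ × ℝ}
    (hF : DifferentiableAt ℂ F (Complex.equivRealProdCLM.symm x)) :
    pd1 (fun y => F (Complex.equivRealProdCLM.symm y)) x =
      deriv F (Complex.equivRealProdCLM.symm x) := by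
  rw [pd1, fderiv_comp_equivRealProdCLM_symm hF]
  simp [Complex.equivRealProdCLM_symm_apply]

theorem pd2_comp_equivRealProdCLM_symm {F : ℂ → ℂ} {x : ℝ × ℝ}
    (hF : DifferentiableAt ℂ F (Complex.equivRealProdCLM.symm x)) :
    pd2 (fun y => F (Complex.equivRealProdCLM.symm y)) x =
      Complex.I * deriv F (Complex.equivRealProdCLM.symm x) := by
  rw [pd2, fderiv_comp_equivRealProdCLM_symm hF]
  simp [Complex.equivRealProdCLM_symm_apply]

theorem pd1_congr {f g : ℝ × ℝ → ℂ} {x : ℝ × ℝ} (h : f =ᶠ[nhds x] g) :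
    pd1 f x = pd1 g x := by
  rw [pd1, pd1, h.fderiv_eq]

theorem pd2_congr {f g : ℝ × ℝ → ℂ} {x : ℝ × ℝ} (h : f =ᶠ[nhds x] g) :
    pd2 f x = pd2 g x := by
  rw [pd2, pd2, h.fderiv_eq]

/-- A function of `x₁ + i x₂` that is holomorphic near a point is harmonic there. -/
theorem laplacian_comp_equivRealProdCLM_symm {F : ℂ → ℂ} {U : Set ℂ} (hU : IsOpen U)
    (hF : DifferentiableOn ℂ F U) {x : ℝ × ℝ} (hx : Complex.equivRealProdCLM.symm x ∈ U) :
    pd1 (pd1 fun y => F (Complex.equivRealProdCLM.symm y)) x +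
      pd2 (pd2 fun y => F (Complex.equivRealProdCLM.symm y)) x = 0 := by
  have hev : ∀ᶠ y in nhds x, Complex.equivRealProdCLM.symm y ∈ U :=
    Complex.equivRealProdCLM.symm.continuous.continuousAt.eventually_mem (hU.mem_nhds hx)
  have hd : DifferentiableAt ℂ (deriv F) (Complex.equivRealProdCLM.symm x) :=
    (hF.deriv hU).differentiableAt (hU.mem_nhds hx)
  rw [pd1_congr (hev.mono fun y hy =>
      pd1_comp_equivRealProdCLM_symm (hF.differentiableAt (hU.mem_nhds hy))),
    pd2_congr (hev.mono fun y hy =>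
      pd2_comp_equivRealProdCLM_symm (hF.differentiableAt (hU.mem_nhds hy))),
    pd1_comp_equivRealProdCLM_symm hd,
    pd2_comp_equivRealProdCLM_symm (F := fun z => Complex.I * deriv F z) (hd.const_mul _),
    deriv_const_mul _ hd, ← mul_assoc, Complex.I_mul_I]
  ring

/-- The CGO vector field `u = (exp(-s√z), i exp(-s√z))` is smooth away from the branch
cut `(-∞,0] × {0}` and satisfies the Lamé equation
`λ Δ u_k + (λ+μ) ∂_k (∂₁u₁ + ∂₂u₂) = 0` there, `k = 1,2`. -/
theorem cgo_smooth_and_lame (lam mu s : ℝ) (hs : 0 < s)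
    (Ω : Set (ℝ × ℝ)) (hΩ : IsOpen Ω)
    (hdisj : Ω ∩ (Set.Iic (0 : ℝ) ×ˢ ({0} : Set ℝ)) = ∅) :
    ContDiffOn ℝ (⊤ : ℕ∞) (cgo s) Ω ∧
    ContDiffOn ℝ (⊤ : ℕ∞) (fun x => Complex.I * cgo s x) Ω ∧
    ∀ x ∈ Ω,
      ((lam : ℂ) * (pd1 (pd1 (cgo s)) x + pd2 (pd2 (cgo s)) x)
          + ((lam : ℂ) + (mu : ℂ)) *
            pd1 (fun y => pd1 (cgo s) y + pd2 (fun z => Complex.I * cgo s z) y) x = 0) ∧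
      ((lam : ℂ) * (pd1 (pd1 (fun z => Complex.I * cgo s z)) x
              + pd2 (pd2 (fun z => Complex.I * cgo s z)) x)
          + ((lam : ℂ) + (mu : ℂ)) *
            pd2 (fun y => pd1 (cgo s) y + pd2 (fun z => Complex.I * cgo s z) y) x = 0) := by
  have hmem : ∀ x ∈ Ω, Complex.equivRealProdCLM.symm x ∈ Complex.slitPlane := by
    intro x hx
    rw [Complex.mem_slitPlane_iff]
    by_contra! h
    have h1 : x ∈ Ω ∩ (Set.Iic (0 : ℝ) ×ˢ ({0} : Set ℝ)) := by
      refine ⟨hx, ?_, ?_⟩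
      · simpa [Complex.equivRealProdCLM_symm_apply] using h.1
      · simpa [Complex.equivRealProdCLM_symm_apply] using h.2
    simp [hdisj] at h1
  have hO := Complex.isOpen_slitPlane
  have hG := differentiableOn_cgoHol s
  have hIG : DifferentiableOn ℂ (fun z => Complex.I * cgoHol s z) Complex.slitPlane :=
    hG.const_mul _
  have hsm : ContDiffOn ℝ (⊤ : ℕ∞) (cgo s) Ω := by
    rw [cgo_eq_cgoHol]
    exact ((hG.contDiffOn hO).restrict_scalars ℝ).comp
      Complex.equivRealProdCLM.symm.contDiff.contDiffOn hmem
  refine ⟨hsm, contDiffOn_const.mul hsm, fun x hx => ?_⟩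
  rw [cgo_eq_cgoHol]
  have hdiv : (fun y => pd1 (fun x => cgoHol s (Complex.equivRealProdCLM.symm x)) y +
      pd2 (fun z => Complex.I * cgoHol s (Complex.equivRealProdCLM.symm z)) y)
      =ᶠ[nhds x] fun _ => 0 := by
    filter_upwards [hΩ.mem_nhds hx] with y hy
    have hy' := hG.differentiableAt (hO.mem_nhds (hmem y hy))
    rw [pd1_comp_equivRealProdCLM_symm hy',
      pd2_comp_equivRealProdCLM_symm (F := fun z => Complex.I * cgoHol s z) (hy'.const_mul _),
      deriv_const_mul _ hy', ← mul_assoc, Complex.I_mul_I]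
    ring
  constructor
  · rw [pd1_congr hdiv, laplacian_comp_equivRealProdCLM_symm hO hG (hmem x hx)]
    simp [pd1]
  · rw [pd2_congr hdiv, laplacian_comp_equivRealProdCLM_symm hO hIG (hmem x hx)]
    simp [pd2]
end

section
/- For −π < θ_m < θ_M < π and s > 0, the function x ↦ exp(−s√(x₁+ix₂)) is Lebesgue integrable on the open sector W = {x ∈ ℝ² ∖ {0} : θ_m < arg(x₁+ix₂) < θ_M}, and ∫_W exp(−s√(x₁+ix₂)) dx = 6i(e^{−2iθ_M} − e^{−2iθ_m}) s^{−4}. -/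
open MeasureTheory Real

/-- The open sector `W = {x ≠ 0 : θ_m < arg(x₁ + i x₂) < θ_M}`. -/
def sector (θm θM : ℝ) : Set (ℝ × ℝ) :=
  {x | x ≠ 0 ∧ θm < Complex.arg ((x.1 : ℂ) + (x.2 : ℂ) * Complex.I) ∧
       Complex.arg ((x.1 : ℂ) + (x.2 : ℂ) * Complex.I) < θM}

theorem integrableOn_pow_mul_cexp_neg_mul_Ioi (n : ℕ) {a : ℂ} (ha : 0 < a.re) :
    IntegrableOn (fun t : ℝ ↦ (t : ℂ) ^ n * Complex.exp (-a * t)) (Set.Ioi 0) := by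
  have h := integrableOn_rpow_mul_exp_neg_mul_rpow (s := n) (p := 1)
    (by linarith [n.cast_nonneg (α := ℝ)]) one_pos ha
  refine Integrable.mono' h (by fun_prop) ?_
  refine (ae_restrict_iff' measurableSet_Ioi).2 (.of_forall fun t ht ↦ le_of_eq ?_)
  simp [Complex.norm_exp, abs_of_pos (Set.mem_Ioi.1 ht)]

theorem tendsto_pow_mul_cexp_neg_mul_atTop (n : ℕ) {a : ℂ} (ha : 0 < a.re) :
    Filter.Tendsto (fun t : ℝ ↦ (t : ℂ) ^ n * Complex.exp (-a * t)) Filter.atTop (nhds 0) := by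
  rw [tendsto_zero_iff_norm_tendsto_zero]
  refine (tendsto_rpow_mul_exp_neg_mul_atTop_nhds_zero n a.re ha).congr' ?_
  filter_upwards [Filter.eventually_gt_atTop 0] with t ht
  simp [Complex.norm_exp, abs_of_pos ht]

theorem integral_pow_mul_cexp_neg_mul_Ioi (n : ℕ) {a : ℂ} (ha : 0 < a.re) :
    ∫ t : ℝ in Set.Ioi 0, (t : ℂ) ^ n * Complex.exp (-a * t) = n.factorial / a ^ (n + 1) := by
  have ha0 : a ≠ 0 := by rintro rfl; simp at ha
  induction n with
  | zero =>
    simp only [pow_zero, one_mul]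
    rw [integral_exp_mul_complex_Ioi (by simpa using ha)]
    simp
  | succ n ih =>
    have hderiv (t : ℝ) : HasDerivAt (fun t : ℝ ↦ (t : ℂ) ^ (n + 1) * Complex.exp (-a * t))
        ((n + 1) * ((t : ℂ) ^ n * Complex.exp (-a * t)) -
          a * ((t : ℂ) ^ (n + 1) * Complex.exp (-a * t))) t := by
      have h1 := ((hasDerivAt_id (t : ℂ)).pow (n + 1)).mul
        ((hasDerivAt_id (t : ℂ)).const_mul (-a)).cexp
      convert! h1.comp_ofReal using 1
      simp
      ring
    have hint := (integrableOn_pow_mul_cexp_neg_mul_Ioi n ha).const_mul (n + 1 : ℂ)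
    have hint' := (integrableOn_pow_mul_cexp_neg_mul_Ioi (n + 1) ha).const_mul a
    have h := integral_Ioi_of_hasDerivAt_of_tendsto' (a := 0) (fun t _ ↦ hderiv t)
      (hint.sub hint') (tendsto_pow_mul_cexp_neg_mul_atTop (n + 1) ha)
    rw [integral_sub hint hint', integral_const_mul, integral_const_mul, ih] at h
    simp only [Complex.ofReal_zero, ne_eq, Nat.succ_ne_zero, not_false_eq_true, zero_pow,
      zero_mul, sub_zero] at h
    rw [Nat.factorial_succ, eq_div_iff (pow_ne_zero _ ha0)]
    rw [sub_eq_zero] at h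
    rw [pow_succ a (n + 1)]
    push_cast
    field_simp at h
    simp only [neg_mul]
    linear_combination -h

theorem integral_mul_cexp_neg_mul_sqrt_Ioi {a : ℂ} (ha : 0 < a.re) :
    ∫ r : ℝ in Set.Ioi 0, (r : ℂ) * Complex.exp (-a * (√r : ℝ)) = 12 / a ^ 4 := by
  rw [← integral_comp_rpow_Ioi_of_pos two_pos]
  have h := integral_pow_mul_cexp_neg_mul_Ioi 3 ha
  rw [show (12 : ℂ) / a ^ 4 = 2 * ((Nat.factorial 3 : ℕ) / a ^ (3 + 1)) by
    norm_num [Nat.factorial]; ring, ← h, ← integral_const_mul]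
  refine setIntegral_congr_fun measurableSet_Ioi fun t ht ↦ ?_
  have ht' : (0 : ℝ) ≤ t := (Set.mem_Ioi.1 ht).le
  norm_num [Real.sqrt_sq ht']
  ring

theorem csqrt_polarCoord_symm {r θ : ℝ} (hr : 0 < r) (hθ : θ ∈ Set.Ioo (-π) π) :
    csqrt (polarCoord.symm (r, θ)) = (√r : ℝ) * Complex.exp ((θ / 2 : ℝ) * Complex.I) := by
  have hz : ((polarCoord.symm (r, θ)).1 : ℂ) + (polarCoord.symm (r, θ)).2 * Complex.I =
      Complex.exp ((Real.log r : ℝ) + θ * Complex.I) := by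
    rw [Complex.exp_add, Complex.exp_mul_I, ← Complex.ofReal_exp, Real.exp_log hr]
    simp
    ring
  have hlog : Complex.log (Complex.exp ((Real.log r : ℝ) + θ * Complex.I)) =
      (Real.log r : ℝ) + θ * Complex.I :=
    Complex.log_exp (by simpa using hθ.1) (by simpa using hθ.2.le)
  have hsqrt : √r = Real.exp (Real.log r / 2) := by rw [Real.exp_half, Real.exp_log hr]
  rw [csqrt, hz, Complex.cpow_def_of_ne_zero (Complex.exp_ne_zero _), hlog, hsqrt,
    Complex.ofReal_exp, ← Complex.exp_add]
  congr 1
  push_cast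
  ring

theorem sector_eq_image_polarCoord_symm {θm θM : ℝ} (hm : -π < θm) (hM : θM < π) :
    sector θm θM = polarCoord.symm '' (Set.Ioi 0 ×ˢ Set.Ioo θm θM) := by
  ext x
  constructor
  · rintro ⟨hx, h1, h2⟩
    have hsource : x ∈ polarCoord.source := by
      have h : (x.1 : ℂ) + x.2 * Complex.I ∈ Complex.slitPlane := by
        refine Complex.mem_slitPlane_iff_arg.2 ⟨(h2.trans hM).ne, fun h0 ↦ hx ?_⟩
        have hre := congrArg Complex.re h0
        have him := congrArg Complex.im h0
        exact Prod.ext (by simpa using hre) (by simpa using him)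
      simpa [Complex.mem_slitPlane_iff] using! h
    have htarget := polarCoord.map_source hsource
    refine ⟨polarCoord x, ⟨htarget.1, ?_⟩, polarCoord.left_inv hsource⟩
    simpa [polarCoord, Complex.equivRealProd_symm_apply] using! And.intro h1 h2
  · rintro ⟨⟨r, θ⟩, ⟨hr, hθ⟩, rfl⟩
    have hr' : 0 < r := hr
    have harg : Complex.arg (((polarCoord.symm (r, θ)).1 : ℂ) +
        (polarCoord.symm (r, θ)).2 * Complex.I) = θ := by
      have h := Complex.arg_mul_cos_add_sin_mul_I hr' (θ := θ)
        ⟨hm.trans hθ.1, (hθ.2.trans hM).le⟩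
      refine Eq.trans (congrArg _ ?_) h
      simp
      ring
    refine ⟨fun h0 ↦ ?_, ?_, ?_⟩
    · have h1 : r * cos θ = 0 := congrArg Prod.fst h0
      have h2 : r * sin θ = 0 := congrArg Prod.snd h0
      have h3 := Real.sin_sq_add_cos_sq θ
      have : r ^ 2 = 0 := by linear_combination (-r ^ 2) * h3 + r * sin θ * h2 + r * cos θ * h1
      exact hr'.ne' (by simpa using this)
    · rw [harg]; exact hθ.1
    · rw [harg]; exact hθ.2

/-- The integrand of `∫ cgo s` in polar coordinates, Jacobian included. -/
noncomputable def cgoPolar (s : ℝ) (p : ℝ × ℝ) : ℂ :=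
  p.1 * Complex.exp (-(s * Complex.exp ((p.2 / 2 : ℝ) * Complex.I)) * (√p.1 : ℝ))

theorem re_ofReal_mul_cexp (s θ : ℝ) :
    ((s : ℂ) * Complex.exp (θ * Complex.I)).re = s * cos θ := by
  simp [Complex.exp_ofReal_mul_I_re]

theorem cos_half_lower_bound {θm θM : ℝ} (hm : -π < θm) (hmM : θm < θM) (hM : θM < π) :
    ∃ c > 0, ∀ θ ∈ Set.Ioo θm θM, c ≤ cos (θ / 2) := by
  have hle : max |θm| |θM| < π := max_lt (abs_lt.2 ⟨hm, hmM.trans hM⟩) (abs_lt.2 ⟨hm.trans hmM, hM⟩)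
  have h0 : 0 ≤ max |θm| |θM| := (abs_nonneg _).trans (le_max_left _ _)
  refine ⟨cos (max |θm| |θM| / 2), cos_pos_of_mem_Ioo ⟨by linarith, by linarith⟩, fun θ hθ ↦ ?_⟩
  rw [← cos_abs (θ / 2), abs_div, abs_two]
  have h := abs_le_max_abs_abs hθ.1.le hθ.2.le
  exact cos_le_cos_of_nonneg_of_le_pi (by positivity) (by linarith) (by linarith)

theorem integrableOn_cgoPolar {θm θM s : ℝ} (hm : -π < θm) (hmM : θm < θM) (hM : θM < π)
    (hs : 0 < s) : IntegrableOn (cgoPolar s) (Set.Ioi 0 ×ˢ Set.Ioo θm θM) := by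
  obtain ⟨c, hc, hcos⟩ := cos_half_lower_bound hm hmM hM
  have hr := integrableOn_rpow_mul_exp_neg_mul_rpow (s := 1) (p := 1 / 2) (by norm_num)
    (by norm_num) (mul_pos hs hc)
  have hθ : IntegrableOn (fun _ : ℝ ↦ (1 : ℝ)) (Set.Ioo θm θM) := integrableOn_const (by simp)
  have h := Integrable.mul_prod hr hθ
  rw [Measure.prod_restrict] at h
  refine Integrable.mono' h ?_ ?_
  · have : Continuous (cgoPolar s) := by unfold cgoPolar; fun_prop
    exact this.aestronglyMeasurable
  · refine (ae_restrict_iff' (measurableSet_Ioi.prod measurableSet_Ioo)).2 (.of_forall ?_)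
    rintro ⟨r, θ⟩ ⟨hr, hθ⟩
    have hr' : 0 < r := hr
    have hre := re_ofReal_mul_cexp s (θ / 2)
    simp only [cgoPolar, norm_mul, Complex.norm_real, Real.norm_eq_abs, abs_of_pos hr',
      Complex.norm_exp, Complex.re_mul_ofReal, Complex.neg_re, hre, rpow_one, mul_one,
      ← Real.sqrt_eq_rpow]
    have := hcos θ hθ
    gcongr

theorem integral_cgoPolar {θm θM s : ℝ} (hm : -π < θm) (hmM : θm < θM) (hM : θM < π)
    (hs : 0 < s) :
    ∫ p in Set.Ioi 0 ×ˢ Set.Ioo θm θM, cgoPolar s p =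
      6 * Complex.I *
        (Complex.exp (-2 * Complex.I * (θM : ℂ)) - Complex.exp (-2 * Complex.I * (θm : ℂ))) *
        (s : ℂ) ^ (-4 : ℤ) := by
  have hradial : ∀ θ ∈ Set.Ioo θm θM, ∫ r in Set.Ioi (0 : ℝ), cgoPolar s (r, θ) =
      12 * (s : ℂ) ^ (-4 : ℤ) * Complex.exp (-2 * Complex.I * θ) := by
    intro θ hθ
    have hcos : 0 < cos (θ / 2) :=
      cos_pos_of_mem_Ioo ⟨by linarith [hθ.1], by linarith [hθ.2]⟩
    have hre : 0 < ((s : ℂ) * Complex.exp ((θ / 2 : ℝ) * Complex.I)).re := by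
      rw [re_ofReal_mul_cexp]; positivity
    simp only [cgoPolar]
    rw [integral_mul_cexp_neg_mul_sqrt_Ioi hre, mul_pow, ← Complex.exp_nat_mul,
      show -2 * Complex.I * (θ : ℂ) = -((4 : ℕ) * ((θ / 2 : ℝ) * Complex.I)) by push_cast; ring,
      Complex.exp_neg, zpow_neg]
    norm_cast
    rw [div_eq_mul_inv, mul_inv, ← mul_assoc]
    push_cast
    rfl
  have hint := integrableOn_cgoPolar hm hmM hM hs
  rw [Measure.volume_eq_prod] at hint ⊢
  rw [← setIntegral_prod_swap, setIntegral_prod (fun z ↦ cgoPolar s z.swap) hint.swap]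
  simp only [Prod.swap_prod_mk]
  rw [setIntegral_congr_fun measurableSet_Ioo hradial, integral_const_mul,
    ← integral_Ioc_eq_integral_Ioo, ← intervalIntegral.integral_of_le hmM.le,
    integral_exp_mul_complex (by simp), ← mul_div_assoc, div_eq_iff (by simp)]
  linear_combination (12 * (s : ℂ) ^ (-4 : ℤ) * (Complex.exp (-2 * Complex.I * θM) -
    Complex.exp (-2 * Complex.I * θm))) * Complex.I_sq

/-- `x ↦ exp(-s√(x₁+ix₂))` is integrable on the sector `W` and
`∫_W exp(-s√z) dx = 6i (e^{-2iθ_M} - e^{-2iθ_m}) s^{-4}`. -/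
theorem cgo_sector_integral (θm θM s : ℝ)
    (hm : -Real.pi < θm) (hmM : θm < θM) (hM : θM < Real.pi) (hs : 0 < s) :
    IntegrableOn (cgo s) (sector θm θM) volume ∧
    ∫ x in sector θm θM, cgo s x =
      6 * Complex.I *
        (Complex.exp (-2 * Complex.I * (θM : ℂ)) - Complex.exp (-2 * Complex.I * (θm : ℂ))) *
        (s : ℂ) ^ (-4 : ℤ) := by
  set A : Set (ℝ × ℝ) := Set.Ioi 0 ×ˢ Set.Ioo θm θM with hA
  have hAm : MeasurableSet A := measurableSet_Ioi.prod measurableSet_Ioo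
  have hsub : A ⊆ polarCoord.target :=
    Set.prod_mono subset_rfl (Set.Ioo_subset_Ioo hm.le hM.le)
  have hinj : Set.InjOn polarCoord.symm A := polarCoord.symm.injOn.mono hsub
  have hderiv : ∀ p ∈ A, HasFDerivWithinAt polarCoord.symm (fderivPolarCoordSymm p) A p :=
    fun p _ ↦ (hasFDerivAt_polarCoord_symm p).hasFDerivWithinAt
  have hcongr : Set.EqOn
      (fun p ↦ |(fderivPolarCoordSymm p).det| • cgo s (polarCoord.symm p)) (cgoPolar s) A := by
    rintro ⟨r, θ⟩ hp
    have hr : 0 < r := hp.1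
    simp only [det_fderivPolarCoordSymm, abs_of_pos hr, cgo,
      csqrt_polarCoord_symm hr (hsub hp).2, cgoPolar, Complex.real_smul]
    congr 2
    ring
  rw [sector_eq_image_polarCoord_symm hm hM, ← hA,
    integrableOn_image_iff_integrableOn_abs_det_fderiv_smul volume hAm hderiv hinj,
    integral_image_eq_integral_abs_det_fderiv_smul volume hAm hderiv hinj,
    integrableOn_congr_fun hcongr hAm, setIntegral_congr_fun hAm hcongr]
  exact ⟨integrableOn_cgoPolar hm hmM hM hs, integral_cgoPolar hm hmM hM hs⟩
end

section
/- Let λ, μ ∈ ℝ and s > 0, and let Ω ⊆ ℝ² be open with Ω ∩ ((−∞,0] × {0}) = ∅. The CGO solution u(x) = (exp(−s√(x₁+ix₂)), i exp(−s√(x₁+ix₂))) satisfies ∂₁u₁ + ∂₂u₂ = 0 and ∂₂u₁ − ∂₁u₂ = 0 at every point of Ω. Consequently, for any unit vector ν ∈ ℝ², the two-dimensional boundary traction T_ν u := 2μ ∂_ν u + λ ν (∂₁u₁ + ∂₂u₂) + μ(∂₂u₁ − ∂₁u₂) ν^⊥ equals 2μ ∂_ν u on Ω, where ∂_ν u = ((∇u₁)·ν,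 (∇u₂)·ν) and ν^⊥ is ν rotated counterclockwise by π/2. -/
open MeasureTheory Real

/-- Real derivative on `ℝ × ℝ` of a holomorphic function of `x₁ + i x₂`. -/
theorem HasDerivAt.hasFDerivAt_comp_ofReal_add_mul_I {g : ℂ → ℂ} {g' : ℂ} {x : ℝ × ℝ}
    (hg : HasDerivAt g g' ((x.1 : ℂ) + (x.2 : ℂ) * Complex.I)) :
    HasFDerivAt (fun y : ℝ × ℝ => g ((y.1 : ℂ) + (y.2 : ℂ) * Complex.I))
      (g' • (Complex.equivRealProdCLM.symm : ℝ × ℝ →L[ℝ] ℂ)) x := by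
  have hφ : HasFDerivAt (fun y : ℝ × ℝ => (y.1 : ℂ) + (y.2 : ℂ) * Complex.I)
      (Complex.equivRealProdCLM.symm : ℝ × ℝ →L[ℝ] ℂ) x :=
    (Complex.equivRealProdCLM.symm : ℝ × ℝ →L[ℝ] ℂ).hasFDerivAt.congr_of_eventuallyEq
      (.of_forall fun y => by simp [Complex.equivRealProdCLM_symm_apply])
  exact hg.comp_hasFDerivAt x hφ

theorem ofReal_add_mul_I_mem_slitPlane {x : ℝ × ℝ}
    (hx : x ∉ Set.Iic (0 : ℝ) ×ˢ ({0} : Set ℝ)) :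
    (x.1 : ℂ) + (x.2 : ℂ) * Complex.I ∈ Complex.slitPlane := by
  rw [Complex.mem_slitPlane_iff]
  by_contra! h
  exact hx (by simpa using h)

/-- The real derivative of `cgo s` off the branch cut is complex multiplication. -/
theorem exists_hasFDerivAt_cgo (s : ℝ) {x : ℝ × ℝ}
    (hx : x ∉ Set.Iic (0 : ℝ) ×ˢ ({0} : Set ℝ)) :
    ∃ c : ℂ, HasFDerivAt (cgo s)
      (c • (Complex.equivRealProdCLM.symm : ℝ × ℝ →L[ℝ] ℂ)) x :=
  ⟨_, HasDerivAt.hasFDerivAt_comp_ofReal_add_mul_I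
    (((((hasDerivAt_id _).cpow_const (c := (1 / 2 : ℂ))
      (ofReal_add_mul_I_mem_slitPlane hx)).const_mul (-(s : ℂ))).cexp))⟩

/-- The CGO field `u = (exp(-s√z), i exp(-s√z))` has vanishing divergence
`∂₁u₁ + ∂₂u₂ = 0` and vanishing curl `∂₂u₁ - ∂₁u₂ = 0` on `Ω`; consequently, for any
unit vector `ν`, the traction `T_ν u = 2μ ∂_ν u + λ ν (∇·u) + μ(∂₂u₁-∂₁u₂)ν^⊥`
reduces to `2μ ∂_ν u` componentwise. -/
theorem cgo_divergence_free_traction (lam mu s : ℝ) (hs : 0 < s)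
    (Ω : Set (ℝ × ℝ)) (hΩ : IsOpen Ω)
    (hdisj : Ω ∩ (Set.Iic (0 : ℝ) ×ˢ ({0} : Set ℝ)) = ∅) :
    ∀ x ∈ Ω,
      (pd1 (cgo s) x + pd2 (fun y => Complex.I * cgo s y) x = 0) ∧
      (pd2 (cgo s) x - pd1 (fun y => Complex.I * cgo s y) x = 0) ∧
      ∀ ν : ℝ × ℝ, ν.1 ^ 2 + ν.2 ^ 2 = 1 →
        (2 * (mu : ℂ) * fderiv ℝ (cgo s) x ν
            + (lam : ℂ) * (ν.1 : ℂ) *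
              (pd1 (cgo s) x + pd2 (fun y => Complex.I * cgo s y) x)
            + (mu : ℂ) * (pd2 (cgo s) x - pd1 (fun y => Complex.I * cgo s y) x) *
              (-(ν.2 : ℂ))
          = 2 * (mu : ℂ) * fderiv ℝ (cgo s) x ν) ∧
        (2 * (mu : ℂ) * fderiv ℝ (fun y => Complex.I * cgo s y) x ν
            + (lam : ℂ) * (ν.2 : ℂ) *
              (pd1 (cgo s) x + pd2 (fun y => Complex.I * cgo s y) x)
            + (mu : ℂ) * (pd2 (cgo s) x - pd1 (fun y => Complex.I * cgo s y) x) *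
              (ν.1 : ℂ)
          = 2 * (mu : ℂ) * fderiv ℝ (fun y => Complex.I * cgo s y) x ν) := by
  intro x hx
  have hcut : x ∉ Set.Iic (0 : ℝ) ×ˢ ({0} : Set ℝ) := fun h =>
    (Set.eq_empty_iff_forall_notMem.mp hdisj x) ⟨hx, h⟩
  obtain ⟨c, hc⟩ := exists_hasFDerivAt_cgo s hcut
  have hIc := hc.const_mul Complex.I
  have hdiv : pd1 (cgo s) x + pd2 (fun y => Complex.I * cgo s y) x = 0 := by
    simp only [pd1, pd2, hc.fderiv, hIc.fderiv]
    simp [Complex.equivRealProdCLM_symm_apply]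
    linear_combination c * Complex.I_mul_I
  have hcurl : pd2 (cgo s) x - pd1 (fun y => Complex.I * cgo s y) x = 0 := by
    simp only [pd1, pd2, hc.fderiv, hIc.fderiv]
    simp [Complex.equivRealProdCLM_symm_apply]
    ring
  refine ⟨hdiv, hcurl, fun ν _ => ⟨?_, ?_⟩⟩ <;> simp [hdiv, hcurl]
end
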